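/- (Rank minimality in an exceptional interval.) Let n ∈ ℕ and p ∈ ℤ with p odd when n > 0. For every dyadic rational t with (p−1)/2ⁿ < t < p/2ⁿ, one has ch₀(ṽ(t)) > ch₀(ṽ(p/2ⁿ)); that is, every exceptional character whose dyadic label lies strictly between (p−1)/2ⁿ and p/2ⁿ has rank strictly greater than the rank of the exceptional character associated to p/2ⁿ. -/

import Mathlib

/-- `vtil m p` is the exceptional character `ṽ(p / 2^m) ∈ ℝ³`, defined recursively:
`ṽ(n) = (1, n, n²/2)` for integers `n`; for odd `p` and `m > 0`,
if `p ≡ 3 (mod 4)` then `ṽ(p/2^m) = 3·ch₀(ṽ((p+1)/2^m))·ṽ((p−1)/2^m) − ṽ((p−3)/2^m)`,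
and if `p ≡ 1 (mod 4)` then `ṽ(p/2^m) = 3·ch₀(ṽ((p−1)/2^m))·ṽ((p+1)/2^m) − ṽ((p+3)/2^m)`.
For even `p` we reduce the fraction, so `vtil` is well defined on dyadic rationals
(each dyadic rational `q` is represented as `p / 2^m`). -/
noncomputable def vtil : ℕ → ℤ → ℝ × ℝ × ℝ
  | 0, p => (1, (p : ℝ), (p : ℝ) ^ 2 / 2)
  | m + 1, p =>
    if p % 2 = 0 then vtil m (p / 2)
    else if p % 4 = 3 then
      (3 * (vtil m ((p + 1) / 2)).1) • vtil m ((p - 1) / 2) - vtil m ((p - 3) / 2)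
    else
      (3 * (vtil m ((p - 1) / 2)).1) • vtil m ((p + 1) / 2) - vtil m ((p + 3) / 2)

lemma vtil_succ_two_mul (m : ℕ) (a : ℤ) : vtil (m + 1) (2 * a) = vtil m a := by
  rw [vtil, if_pos (by omega)]
  congr 1
  omega

lemma vtil_succ_right_child_rank (m : ℕ) (b : ℤ) (hb : b % 2 = 1) :
    (vtil (m + 1) (2 * b + 1)).1 =
      3 * (vtil m (b + 1)).1 * (vtil m b).1 - (vtil m (b - 1)).1 := by
  rw [vtil, if_neg (by omega), if_pos (by omega),
    show (2 * b + 1 + 1) / 2 = b + 1 by omega, show (2 * b + 1 - 1) / 2 = b by omega,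
    show (2 * b + 1 - 3) / 2 = b - 1 by omega]
  simp

lemma vtil_succ_left_child_rank (m : ℕ) (b : ℤ) (hb : b % 2 = 1) :
    (vtil (m + 1) (2 * b - 1)).1 =
      3 * (vtil m (b - 1)).1 * (vtil m b).1 - (vtil m (b + 1)).1 := by
  rw [vtil, if_neg (by omega), if_neg (by omega),
    show (2 * b - 1 - 1) / 2 = b - 1 by omega, show (2 * b - 1 + 1) / 2 = b by omega,
    show (2 * b - 1 + 3) / 2 = b + 1 by omega]
  simp

/-- All ranks are at least one, an odd label has rank at least that of its neighbours, and a label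
new at level `m + 1` has rank strictly larger than its neighbours, which come from level `m`. -/
lemma vtil_rank_invariant (m : ℕ) :
    (∀ a, 1 ≤ (vtil m a).1) ∧
    (∀ b, b % 2 = 1 → (vtil m (b - 1)).1 ≤ (vtil m b).1 ∧ (vtil m (b + 1)).1 ≤ (vtil m b).1) ∧
    (∀ a, (vtil m a).1 < (vtil (m + 1) (2 * a + 1)).1 ∧
      (vtil m (a + 1)).1 < (vtil (m + 1) (2 * a + 1)).1) := by
  have child : ∀ m : ℕ, (∀ a, 1 ≤ (vtil m a).1) →
      (∀ b, b % 2 = 1 → (vtil m (b - 1)).1 ≤ (vtil m b).1 ∧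
        (vtil m (b + 1)).1 ≤ (vtil m b).1) →
      ∀ a, (vtil m a).1 < (vtil (m + 1) (2 * a + 1)).1 ∧
        (vtil m (a + 1)).1 < (vtil (m + 1) (2 * a + 1)).1 := by
    intro m one_le le a
    rcases Int.emod_two_eq_zero_or_one a with h | h
    · have hb : (a + 1) % 2 = 1 := by omega
      have e := vtil_succ_left_child_rank m (a + 1) hb
      rw [show 2 * (a + 1) - 1 = 2 * a + 1 by ring, add_sub_cancel_right] at e
      have l := le (a + 1) hb
      rw [add_sub_cancel_right] at l
      have := one_le a
      have := one_le (a + 1)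
      rw [e]
      constructor <;> nlinarith
    · have e := vtil_succ_right_child_rank m a h
      have l := le a h
      have := one_le a
      have := one_le (a + 1)
      rw [e]
      constructor <;> nlinarith
  induction m with
  | zero =>
    have one_le : ∀ a, 1 ≤ (vtil 0 a).1 := by simp [vtil]
    have le : ∀ b : ℤ, b % 2 = 1 → (vtil 0 (b - 1)).1 ≤ (vtil 0 b).1 ∧
        (vtil 0 (b + 1)).1 ≤ (vtil 0 b).1 := by simp [vtil]
    exact ⟨one_le, le, child 0 one_le le⟩
  | succ m ih =>
    obtain ⟨one_le, -, lt⟩ := ih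
    have one_le' : ∀ a, 1 ≤ (vtil (m + 1) a).1 := by
      intro a
      obtain ⟨c, rfl | rfl⟩ := Int.even_or_odd' a
      · rw [vtil_succ_two_mul]
        exact one_le c
      · exact (one_le c).trans (lt c).1.le
    have le' : ∀ b : ℤ, b % 2 = 1 → (vtil (m + 1) (b - 1)).1 ≤ (vtil (m + 1) b).1 ∧
        (vtil (m + 1) (b + 1)).1 ≤ (vtil (m + 1) b).1 := by
      intro b hb
      obtain ⟨c, rfl⟩ : ∃ c, b = 2 * c + 1 := ⟨b / 2, by omega⟩
      rw [add_sub_cancel_right, show 2 * c + 1 + 1 = 2 * (c + 1) by ring, vtil_succ_two_mul,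
        vtil_succ_two_mul]
      exact ⟨(lt c).1.le, (lt c).2.le⟩
    exact ⟨one_le', le', child (m + 1) one_le' le'⟩

lemma vtil_rank_lt_of_mem_interval (n : ℕ) (p : ℤ) (j : ℕ) (q : ℤ)
    (h₁ : (p - 1) * 2 ^ j < q) (h₂ : q < p * 2 ^ j) :
    (vtil n p).1 < (vtil (n + j) q).1 := by
  induction j generalizing q with
  | zero => simp at h₁ h₂; omega
  | succ j ih =>
    rw [← add_assoc]
    rw [pow_succ, ← mul_assoc] at h₁ h₂
    obtain ⟨c, rfl | rfl⟩ := Int.even_or_odd' q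
    · rw [vtil_succ_two_mul]
      exact ih c (by omega) (by omega)
    · have lt := ((vtil_rank_invariant (n + j)).2.2 c).2
      rcases eq_or_ne (c + 1) (p * 2 ^ j) with e | e
      · have endpoint : vtil (n + j) (p * 2 ^ j) = vtil n p := by
          clear * -
          induction j with
          | zero => simp
          | succ j ih =>
            rw [← add_assoc, pow_succ, ← mul_assoc, mul_comm _ 2, vtil_succ_two_mul, ih]
        rwa [e, endpoint] at lt
      · exact (ih (c + 1) (by omega) (by omega)).trans lt

/-- Rank minimality in an exceptional interval: let `n ∈ ℕ`, `p ∈ ℤ` (`p` odd when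
`n > 0`). Every exceptional character whose dyadic label `t = q/2^k` lies strictly between
`(p−1)/2ⁿ` and `p/2ⁿ` has rank strictly greater than the rank of `ṽ(p/2ⁿ)`. -/
theorem rank_minimality_in_exceptional_interval (n : ℕ) (p : ℤ) (hp : 0 < n → Odd p)
    (k : ℕ) (q : ℤ)
    (h₁ : ((p : ℝ) - 1) / 2 ^ n < (q : ℝ) / 2 ^ k)
    (h₂ : (q : ℝ) / 2 ^ k < (p : ℝ) / 2 ^ n) :
    (vtil n p).1 < (vtil k q).1 := by
  rw [div_lt_div_iff₀ (by positivity) (by positivity)] at h₁ h₂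
  have h₁' : (p - 1) * 2 ^ k < q * 2 ^ n := by exact_mod_cast h₁
  have h₂' : q * 2 ^ n < p * 2 ^ k := by exact_mod_cast h₂
  rcases le_total n k with h | h
  · obtain ⟨j, rfl⟩ := Nat.exists_eq_add_of_le h
    rw [pow_add, mul_left_comm, mul_comm q] at h₁' h₂'
    have pos : (0 : ℤ) < 2 ^ n := by positivity
    exact vtil_rank_lt_of_mem_interval n p j q (lt_of_mul_lt_mul_left h₁' pos.le)
      (lt_of_mul_lt_mul_left h₂' pos.le)
  · obtain ⟨j, rfl⟩ := Nat.exists_eq_add_of_le h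
    rw [pow_add, mul_left_comm, mul_comm _ ((2 : ℤ) ^ k)] at h₁' h₂'
    have pos : (0 : ℤ) < 2 ^ k := by positivity
    have := lt_of_mul_lt_mul_left h₁' pos.le
    have := lt_of_mul_lt_mul_left h₂' pos.le
    omega
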